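/- Let φ: X → ℝ be a bounded continuous function for which there exist M > 0 and a neighborhood U of the identity in SL(2,ℝ) such that |φ(h·y) − φ(y)| ≤ M‖h − I‖ for all h ∈ U and all y ∈ X. Fix x ∈ X and 0 < α < 1, and for t ≥ 0 set α_t = arctan(α e^{−2t}) and f_t(θ) = φ(g_t r_θ · x) − φ(g_t r_{θ + α_t} · x). Then for Lebesgue-almost every θ ∈ [0, 2π], lim_{T → ∞} (1/T) ∫₀^T f_t(θ) dt = 0. -/

import Mathlib

open MeasureTheory Filter Topology Matrix Real

/-- `SL(2,ℝ)`: the group of 2×2 real matrices of determinant 1. -/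
abbrev SL2 : Type := Matrix.SpecialLinearGroup (Fin 2) ℝ

/-- The topology on `SL(2,ℝ)` induced from the space of 2×2 real matrices. -/
noncomputable instance : TopologicalSpace SL2 :=
  TopologicalSpace.induced (fun g : SL2 => (g : Matrix (Fin 2) (Fin 2) ℝ)) inferInstance

/-- The diagonal matrix `g_t = [[eᵗ, 0], [0, e⁻ᵗ]]` as an element of `SL(2,ℝ)`. -/
noncomputable def gMat (t : ℝ) : SL2 :=
  ⟨!![Real.exp t, 0; 0, Real.exp (-t)], by
    simp [Matrix.det_fin_two_of, ← Real.exp_add]⟩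

/-- The rotation matrix `r_θ = [[cos θ, sin θ], [−sin θ, cos θ]]` as an element of `SL(2,ℝ)`. -/
noncomputable def rMat (θ : ℝ) : SL2 :=
  ⟨!![Real.cos θ, Real.sin θ; -Real.sin θ, Real.cos θ], by
    simp [Matrix.det_fin_two_of]; nlinarith [Real.sin_sq_add_cos_sq θ]⟩

/-- The operator norm of a 2×2 real matrix (as an operator on Euclidean ℝ²). -/
noncomputable def opNorm2 (m : Matrix (Fin 2) (Fin 2) ℝ) : ℝ :=
  ‖Matrix.toEuclideanCLM (𝕜 := ℝ) m‖

/-- If the Cesàro averages of a bounded function converge to `0` along the squares, then they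
converge to `0`. -/
theorem tendsto_average_of_tendsto_average_sq {g : ℝ → ℝ} {K : ℝ} (hg : Measurable g)
    (hK : ∀ t, |g t| ≤ K)
    (hsq : Tendsto (fun n : ℕ => ((n : ℝ) ^ 2)⁻¹ * ∫ t in (0:ℝ)..(n : ℝ) ^ 2, g t) atTop (𝓝 0)) :
    Tendsto (fun T : ℝ => T⁻¹ * ∫ t in (0:ℝ)..T, g t) atTop (𝓝 0) := by
  have hint (a b : ℝ) : IntervalIntegrable g volume a b :=
    (intervalIntegrable_const (c := K)).mono_fun hg.aestronglyMeasurable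
      (Eventually.of_forall fun t => by
        simpa using (hK t).trans (le_abs_self K))
  have hK0 : 0 ≤ K := (abs_nonneg _).trans (hK 0)
  have hfloor : Tendsto (fun T : ℝ => ⌊√T⌋₊) atTop atTop :=
    tendsto_nat_floor_atTop.comp Real.tendsto_sqrt_atTop
  have hrem : Tendsto (fun T : ℝ => K * (2 * (√T)⁻¹)) atTop (𝓝 0) := by
    simpa using ((tendsto_inv_atTop_zero.comp Real.tendsto_sqrt_atTop).const_mul 2).const_mul K
  have hbound := (hsq.comp hfloor).abs.add hrem
  rw [abs_zero, add_zero] at hbound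
  refine squeeze_zero_norm' ?_ hbound
  filter_upwards [eventually_ge_atTop 1] with T hT
  have hsT : 1 ≤ √T := Real.one_le_sqrt.2 hT
  have hT0 : 0 < T := by linarith
  have hTT : √T * √T = T := Real.mul_self_sqrt hT0.le
  simp only [Function.comp_apply, Real.norm_eq_abs]
  set n := ⌊√T⌋₊
  have hn : (n : ℝ) ≤ √T := Nat.floor_le (Real.sqrt_nonneg T)
  have hn' : √T < n + 1 := Nat.lt_floor_add_one _
  have hn1 : (1 : ℝ) ≤ n := by exact_mod_cast Nat.le_floor (by simpa using hsT)
  have hnT : (n : ℝ) ^ 2 ≤ T := by nlinarith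
  have hdiff : |∫ t in (n : ℝ) ^ 2..T, g t| ≤ K * (2 * √T) := by
    refine (intervalIntegral.norm_integral_le_of_norm_le_const (f := g) (C := K) fun t _ => hK t).trans ?_
    rw [abs_of_nonneg (by linarith)]
    gcongr
    nlinarith
  rw [← intervalIntegral.integral_add_adjacent_intervals (hint 0 ((n : ℝ) ^ 2)) (hint _ T),
    mul_add]
  refine (abs_add_le _ _).trans (add_le_add ?_ ?_)
  · have hn0 : (0 : ℝ) < (n : ℝ) ^ 2 := by positivity
    rw [abs_mul, abs_mul, abs_of_pos (inv_pos.2 hT0), abs_of_pos (inv_pos.2 hn0)]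
    gcongr
  · rw [abs_mul, abs_of_pos (inv_pos.2 hT0)]
    calc T⁻¹ * |∫ t in (n : ℝ) ^ 2..T, g t| ≤ T⁻¹ * (K * (2 * √T)) := by gcongr
      _ = K * (2 * (√T)⁻¹) := by
        have : √T ≠ 0 := by positivity
        nth_rewrite 1 [← hTT]
        field_simp

section StrongLaw

variable {Ω : Type*} [MeasurableSpace Ω] {μ : Measure Ω} [IsFiniteMeasure μ]
  {f : ℝ → Ω → ℝ} {K : ℝ} {k : ℝ → ℝ}

/-- Second moment bound for the time integral of a process with integrable correlations. -/
theorem integral_sq_intervalIntegral_le (hf : Measurable (Function.uncurry f))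
    (hK : ∀ t ω, |f t ω| ≤ K) (hk : Integrable k) (hk0 : ∀ u, 0 ≤ k u)
    (hcorr : ∀ s t, 0 ≤ s → 0 ≤ t → |∫ ω, f s ω * f t ω ∂μ| ≤ k (t - s)) {T : ℝ} (hT : 0 ≤ T) :
    ∫ ω, (∫ t in (0:ℝ)..T, f t ω) ^ 2 ∂μ ≤ T * ∫ u, k u := by
  set ν : Measure ℝ := volume.restrict (Set.Ioc 0 T)
  have hm : Measurable (Function.uncurry fun (ω : Ω) (p : ℝ × ℝ) => f p.1 ω * f p.2 ω) :=
    (hf.comp (by fun_prop : Measurable fun q : Ω × (ℝ × ℝ) => (q.2.1, q.1))).mul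
      (hf.comp (by fun_prop : Measurable fun q : Ω × (ℝ × ℝ) => (q.2.2, q.1)))
  have hb : ∀ q, ‖Function.uncurry (fun (ω : Ω) (p : ℝ × ℝ) => f p.1 ω * f p.2 ω) q‖ ≤ K * K := by
    rintro ⟨ω, p⟩
    simp only [Function.uncurry, Real.norm_eq_abs, abs_mul]
    exact mul_le_mul (hK _ _) (hK _ _) (abs_nonneg _) ((abs_nonneg _).trans (hK p.1 ω))
  have hi : Integrable (Function.uncurry fun (ω : Ω) (p : ℝ × ℝ) => f p.1 ω * f p.2 ω)
      (μ.prod (ν.prod ν)) :=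
    .of_bound hm.aestronglyMeasurable (K * K) (Eventually.of_forall hb)
  have hshift (s : ℝ) : Integrable fun t => k (t - s) := hk.comp_sub_right s
  calc ∫ ω, (∫ t in (0:ℝ)..T, f t ω) ^ 2 ∂μ
      = ∫ ω, ∫ p, f p.1 ω * f p.2 ω ∂(ν.prod ν) ∂μ := by
        refine integral_congr_ae (Eventually.of_forall fun ω => ?_)
        simp only [intervalIntegral.integral_of_le hT]
        rw [integral_prod_mul (fun t => f t ω) (fun t => f t ω), sq]
    _ = ∫ p, ∫ ω, f p.1 ω * f p.2 ω ∂μ ∂(ν.prod ν) := integral_integral_swap hi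
    _ = ∫ s, ∫ t, ∫ ω, f s ω * f t ω ∂μ ∂ν ∂ν := integral_prod _ hi.integral_prod_right
    _ ≤ ∫ _, (∫ u, k u) ∂ν := by
        refine integral_mono_ae hi.integral_prod_right.integral_prod_left (integrable_const _) ?_
        filter_upwards [hi.integral_prod_right.prod_right_ae,
          ae_restrict_mem measurableSet_Ioc] with s hs hsT
        calc ∫ t, ∫ ω, f s ω * f t ω ∂μ ∂ν ≤ ∫ t, k (t - s) ∂ν := by
              refine integral_mono_ae hs (hshift s).restrict ?_
              filter_upwards [ae_restrict_mem measurableSet_Ioc] with t htT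
              exact (le_abs_self _).trans (hcorr s t hsT.1.le htT.1.le)
          _ ≤ ∫ t, k (t - s) :=
              setIntegral_le_integral (hshift s) (Eventually.of_forall fun t => hk0 _)
          _ = ∫ u, k u := integral_sub_right_eq_self k s
    _ = T * ∫ u, k u := by simp [ν, hT]

/-- Strong law of large numbers for a bounded process with integrable correlations. -/
theorem ae_tendsto_average_of_integrable_correlation (hf : Measurable (Function.uncurry f))
    (hK : ∀ t ω, |f t ω| ≤ K) (hk : Integrable k) (hk0 : ∀ u, 0 ≤ k u)
    (hcorr : ∀ s t, 0 ≤ s → 0 ≤ t → |∫ ω, f s ω * f t ω ∂μ| ≤ k (t - s)) :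
    ∀ᵐ ω ∂μ, Tendsto (fun T : ℝ => T⁻¹ * ∫ t in (0:ℝ)..T, f t ω) atTop (𝓝 0) := by
  set A : ℕ → Ω → ℝ := fun n ω => ((n : ℝ) ^ 2)⁻¹ * ∫ t in (0:ℝ)..(n : ℝ) ^ 2, f t ω
  have hAm (n : ℕ) : Measurable (A n) := by
    simp only [A, intervalIntegral.integral_of_le (sq_nonneg (n : ℝ))]
    refine Measurable.const_mul ?_ _
    exact (StronglyMeasurable.integral_prod_right (f := fun ω t => f t ω)
      (hf.comp measurable_swap).stronglyMeasurable).measurable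
  have hAb (n : ℕ) (ω : Ω) : |A n ω| ≤ K := by
    have hK0 : 0 ≤ K := (abs_nonneg _).trans (hK 0 ω)
    have h := intervalIntegral.norm_integral_le_of_norm_le_const (a := 0) (b := (n : ℝ) ^ 2)
      (f := fun t => f t ω) (C := K) fun t _ => hK t ω
    rw [sub_zero, abs_of_nonneg (sq_nonneg (n : ℝ)), Real.norm_eq_abs] at h
    rw [abs_mul, abs_of_nonneg (by positivity)]
    rcases eq_or_ne n 0 with rfl | hn
    · simpa using hK0
    · have hn' : (0 : ℝ) < (n : ℝ) ^ 2 := by positivity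
      rw [inv_mul_le_iff₀ hn']
      linarith
  have hAi (n : ℕ) : Integrable (fun ω => A n ω ^ 2) μ :=
    .of_bound ((hAm n).pow_const 2).aestronglyMeasurable (K ^ 2) (Eventually.of_forall fun ω => by
      rw [norm_pow, Real.norm_eq_abs]
      exact pow_le_pow_left₀ (abs_nonneg _) (hAb n ω) 2)
  have hA2 (n : ℕ) : ∫ ω, A n ω ^ 2 ∂μ ≤ (1 / (n : ℝ) ^ 2) * ∫ u, k u := by
    simp only [A, mul_pow, integral_const_mul]
    have h := integral_sq_intervalIntegral_le hf hK hk hk0 hcorr (sq_nonneg (n : ℝ))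
    rcases eq_or_ne n 0 with rfl | hn
    · simp
    · calc _ ≤ (((n : ℝ) ^ 2)⁻¹) ^ 2 * ((n : ℝ) ^ 2 * ∫ u, k u) := by gcongr
        _ = _ := by field_simp
  have hsum : Summable fun n => ∫ ω, A n ω ^ 2 ∂μ :=
    .of_nonneg_of_le (fun n => integral_nonneg fun ω => sq_nonneg _) hA2
      ((Real.summable_one_div_nat_pow.2 one_lt_two).mul_right _)
  have hlint : ∫⁻ ω, ∑' n, ENNReal.ofReal (A n ω ^ 2) ∂μ ≠ ⊤ := by
    rw [lintegral_tsum fun n => ((hAm n).pow_const 2).ennreal_ofReal.aemeasurable]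
    simp_rw [← ofReal_integral_eq_lintegral_ofReal (hAi _)
      (Eventually.of_forall fun ω => sq_nonneg _)]
    exact hsum.tsum_ofReal_ne_top
  filter_upwards [ae_lt_top
    (Measurable.tsum fun n => ((hAm n).pow_const 2).ennreal_ofReal) hlint] with ω hω
  refine tendsto_average_of_tendsto_average_sq (hf.comp measurable_prodMk_right)
    (fun t => hK t ω) ?_
  have h0 : Tendsto (fun n => A n ω ^ 2) atTop (𝓝 0) := by
    have h := (ENNReal.tendsto_toReal ENNReal.zero_ne_top).comp
      (ENNReal.tendsto_atTop_zero_of_tsum_ne_top hω.ne)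
    refine h.congr fun n => ?_
    simp [ENNReal.toReal_ofReal (sq_nonneg (A n ω))]
  rw [tendsto_zero_iff_abs_tendsto_zero]
  have h1 := (Real.continuous_sqrt.tendsto 0).comp h0
  rw [Real.sqrt_zero] at h1
  exact h1.congr fun n => Real.sqrt_sq_eq_abs _

end StrongLaw

theorem integrable_exp_neg_mul_abs {c : ℝ} (hc : 0 < c) :
    Integrable fun u : ℝ => Real.exp (-c * |u|) := by
  rw [← integrableOn_univ, ← Set.Iic_union_Ioi (a := (0 : ℝ))]
  refine IntegrableOn.union ?_ ?_
  · refine (integrableOn_exp_mul_Iic hc 0).congr_fun (fun u hu => ?_) measurableSet_Iic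
    simp [abs_of_nonpos (Set.mem_Iic.1 hu)]
  · refine (integrableOn_exp_mul_Ioi (neg_lt_zero.2 hc) 0).congr_fun (fun u hu => ?_)
      measurableSet_Ioi
    simp [abs_of_pos (Set.mem_Ioi.1 hu)]

theorem arctan_le_self {y : ℝ} (hy : 0 ≤ y) : Real.arctan y ≤ y := by
  simpa using Real.le_tan (Real.arctan_nonneg.2 hy) (Real.arctan_lt_pi_div_two y)

theorem opNorm2_nonneg (m : Matrix (Fin 2) (Fin 2) ℝ) : 0 ≤ opNorm2 m := norm_nonneg _

theorem exists_opNorm2_le :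
    ∃ D : ℝ, 0 ≤ D ∧ ∀ (m : Matrix (Fin 2) (Fin 2) ℝ) (ε : ℝ),
      (∀ i j, |m i j| ≤ ε) → opNorm2 m ≤ D * ε := by
  refine ⟨∑ i, ∑ j, opNorm2 (Matrix.single i j 1),
    Finset.sum_nonneg fun i _ => Finset.sum_nonneg fun j _ => opNorm2_nonneg _, fun m ε hm => ?_⟩
  have hsingle (i j : Fin 2) : opNorm2 (Matrix.single i j (m i j)) ≤
      opNorm2 (Matrix.single i j 1) * ε := by
    have : Matrix.single i j (m i j) = m i j • Matrix.single i j (1 : ℝ) := by simp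
    rw [opNorm2, this, map_smul, norm_smul, mul_comm]
    exact mul_le_mul_of_nonneg_left (hm i j) (norm_nonneg _)
  calc opNorm2 m = opNorm2 (∑ i, ∑ j, Matrix.single i j (m i j)) := by
        rw [← Matrix.matrix_eq_sum_single]
    _ ≤ ∑ i, ∑ j, opNorm2 (Matrix.single i j (m i j)) := by
        simp only [opNorm2, map_sum]
        exact (norm_sum_le _ _).trans (Finset.sum_le_sum fun i _ => norm_sum_le _ _)
    _ ≤ ∑ i, ∑ j, opNorm2 (Matrix.single i j 1) * ε :=
        Finset.sum_le_sum fun i _ => Finset.sum_le_sum fun j _ => hsingle i j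
    _ = _ := by simp only [Finset.sum_mul]

theorem exists_forall_opNorm2_sub_one_lt_mem {U : Set SL2} (hU : U ∈ 𝓝 (1 : SL2)) :
    ∃ ε > 0, ∀ h : SL2, opNorm2 ((h : Matrix (Fin 2) (Fin 2) ℝ) - 1) < ε → h ∈ U := by
  obtain ⟨V, hV, hVU⟩ := (mem_nhds_induced _ _ _).1 hU
  set L := (Matrix.toEuclideanCLM (n := Fin 2) (𝕜 := ℝ))
  have hcont : Continuous fun A => L.symm A :=
    LinearMap.continuous_of_finiteDimensional L.symm.toAlgEquiv.toLinearMap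
  have hpre : (fun A => L.symm A) ⁻¹' V ∈ 𝓝 (1 : _ →L[ℝ] _) := by
    refine hcont.continuousAt.preimage_mem_nhds ?_
    simpa using hV
  obtain ⟨ε, hε, hball⟩ := Metric.mem_nhds_iff.1 hpre
  refine ⟨ε, hε, fun h hh => hVU ?_⟩
  have : L (h : Matrix (Fin 2) (Fin 2) ℝ) ∈ Metric.ball (1 : _ →L[ℝ] _) ε := by
    rw [mem_ball_iff_norm]
    simpa [opNorm2, map_sub] using hh
  simpa using hball this

/-- A bounded function that is Lipschitz in the group variable near the identity is Lipschitz in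
the group variable over the whole group. -/
theorem exists_forall_abs_smul_sub_le {X : Type*} [MulAction SL2 X] {φ : X → ℝ} {B M : ℝ}
    (hB : ∀ y, |φ y| ≤ B) (hM : 0 < M) {U : Set SL2} (hU : U ∈ 𝓝 (1 : SL2))
    (hlip : ∀ h ∈ U, ∀ y : X,
      |φ (h • y) - φ y| ≤ M * opNorm2 ((h : Matrix (Fin 2) (Fin 2) ℝ) - 1)) :
    ∃ N : ℝ, 0 ≤ N ∧ ∀ (h : SL2) (y : X),
      |φ (h • y) - φ y| ≤ N * opNorm2 ((h : Matrix (Fin 2) (Fin 2) ℝ) - 1) := by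
  obtain ⟨ε, hε, hεU⟩ := exists_forall_opNorm2_sub_one_lt_mem hU
  refine ⟨max M (2 * B / ε), le_max_of_le_left hM.le, fun h y => ?_⟩
  rcases lt_or_ge (opNorm2 ((h : Matrix (Fin 2) (Fin 2) ℝ) - 1)) ε with hlt | hge
  · exact (hlip h (hεU h hlt) y).trans
      (mul_le_mul_of_nonneg_right (le_max_left _ _) (opNorm2_nonneg _))
  · have hB0 : 0 ≤ B := (abs_nonneg _).trans (hB y)
    calc |φ (h • y) - φ y| ≤ |φ (h • y)| + |φ y| := abs_sub _ _
      _ ≤ 2 * B / ε * ε := by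
          rw [div_mul_cancel₀ _ hε.ne']
          linarith [hB (h • y), hB y]
      _ ≤ _ := mul_le_mul (le_max_right _ _) hge hε.le (le_max_of_le_left hM.le)

theorem coe_gMat (t : ℝ) : (gMat t : Matrix (Fin 2) (Fin 2) ℝ) =
    !![Real.exp t, 0; 0, Real.exp (-t)] := rfl

theorem coe_rMat (θ : ℝ) : (rMat θ : Matrix (Fin 2) (Fin 2) ℝ) =
    !![Real.cos θ, Real.sin θ; -Real.sin θ, Real.cos θ] := rfl

theorem continuous_gMat_mul_rMat : Continuous fun p : ℝ × ℝ => gMat p.1 * rMat p.2 := by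
  refine continuous_induced_rng.2 (continuous_matrix fun i j => ?_)
  fin_cases i <;> fin_cases j <;>
    simp [coe_gMat, coe_rMat, Matrix.mul_apply, Fin.sum_univ_two] <;> fun_prop

theorem rMat_add_two_pi (θ : ℝ) : rMat (θ + 2 * π) = rMat θ := by
  apply Subtype.ext
  simp [rMat]

theorem rMat_add (θ δ : ℝ) : rMat (θ + δ) = rMat δ * rMat θ := by
  apply Subtype.ext
  ext i j
  fin_cases i <;> fin_cases j <;>
    simp [coe_rMat, Matrix.mul_apply, Fin.sum_univ_two, Real.sin_add, Real.cos_add] <;> ring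

theorem gMat_neg_mul (s : ℝ) : gMat (-s) * gMat s = 1 := by
  apply Subtype.ext
  ext i j
  fin_cases i <;> fin_cases j <;>
    simp [coe_gMat, Matrix.mul_apply, Fin.sum_univ_two, ← Real.exp_add]

theorem abs_conj_rMat_sub_one_apply_le {s : ℝ} (hs : 0 ≤ s) (δ : ℝ) (i j : Fin 2) :
    |((gMat s * rMat δ * gMat (-s) : SL2) - 1 : Matrix (Fin 2) (Fin 2) ℝ) i j| ≤
      Real.exp (2 * s) * |δ| := by
  have hsin : |Real.sin δ| ≤ |δ| := Real.abs_sin_le_abs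
  have hcos : |Real.cos δ - 1| ≤ |δ| := by simpa using Real.abs_cos_sub_cos_le δ 0
  have h1 : 1 ≤ Real.exp (2 * s) := Real.one_le_exp (by linarith)
  have hδ : |δ| ≤ Real.exp (2 * s) * |δ| := le_mul_of_one_le_left (abs_nonneg _) h1
  have hexp : Real.exp s * Real.exp s = Real.exp (2 * s) := by rw [← Real.exp_add]; ring_nf
  have hexp' : Real.exp (-s) * Real.exp (-s) ≤ Real.exp (2 * s) := by
    rw [← Real.exp_add]; exact Real.exp_le_exp.2 (by linarith)
  have hinv : Real.exp s * Real.exp (-s) = 1 := by simp [← Real.exp_add]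
  fin_cases i <;> fin_cases j <;>
    simp [coe_gMat, coe_rMat]
  · rw [mul_right_comm, hinv, one_mul]; exact hcos.trans hδ
  · rw [mul_right_comm, hexp]; gcongr
  · rw [mul_right_comm]; gcongr
  · rw [mul_right_comm, mul_comm (Real.exp (-s)), hinv, one_mul]; exact hcos.trans hδ

/-- Oscillation of `θ ↦ φ (g_s r_θ x)` at scale `δ`. -/
theorem exists_forall_abs_orbit_sub_le {X : Type*} [MulAction SL2 X] {φ : X → ℝ} {N : ℝ}
    (hN : 0 ≤ N) (hlip : ∀ (h : SL2) (y : X),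
      |φ (h • y) - φ y| ≤ N * opNorm2 ((h : Matrix (Fin 2) (Fin 2) ℝ) - 1)) (x : X) :
    ∃ C : ℝ, 0 ≤ C ∧ ∀ s, 0 ≤ s → ∀ θ δ : ℝ,
      |φ ((gMat s * rMat (θ + δ)) • x) - φ ((gMat s * rMat θ) • x)| ≤
        C * (Real.exp (2 * s) * |δ|) := by
  obtain ⟨D, hD, hop⟩ := exists_opNorm2_le
  refine ⟨N * D, mul_nonneg hN hD, fun s hs θ δ => ?_⟩
  have hconj : gMat s * rMat (θ + δ) = (gMat s * rMat δ * gMat (-s)) * (gMat s * rMat θ) := by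
    rw [rMat_add]
    calc _ = gMat s * rMat δ * 1 * rMat θ := by group
      _ = _ := by rw [← gMat_neg_mul s]; group
  rw [hconj, mul_smul, mul_assoc N]
  refine (hlip _ _).trans (mul_le_mul_of_nonneg_left ?_ hN)
  exact hop _ _ (abs_conj_rMat_sub_one_apply_le hs δ)

/-- A periodic function differenced at scale `a` is nearly orthogonal to functions that vary
slowly at that scale. -/
theorem abs_integral_mul_sub_translate_le {F h : ℝ → ℝ} {P B η a : ℝ} (hP : 0 ≤ P)
    (hFc : Continuous F) (hhc : Continuous h) (hF : Function.Periodic F P)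
    (hh : Function.Periodic h P) (hFB : ∀ θ, |F θ| ≤ B) (hη : ∀ θ, |h θ - h (θ - a)| ≤ η) :
    |∫ θ in (0:ℝ)..P, h θ * (F θ - F (θ + a))| ≤ B * η * P := by
  have hper : Function.Periodic (fun θ => h (θ - a) * F θ) P := fun θ => by
    simp only [hF θ, add_sub_right_comm θ P a, hh (θ - a)]
  have hshift : ∫ θ in (0:ℝ)..P, h θ * F (θ + a) = ∫ θ in (0:ℝ)..P, h (θ - a) * F θ := by
    have h1 := intervalIntegral.integral_comp_add_right (a := 0) (b := P)
      (fun θ => h (θ - a) * F θ) a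
    simp only [add_sub_cancel_right] at h1
    rw [h1, zero_add, add_comm P a, hper.intervalIntegral_add_eq a 0, zero_add]
  have heq : ∫ θ in (0:ℝ)..P, h θ * (F θ - F (θ + a)) =
      ∫ θ in (0:ℝ)..P, (h θ - h (θ - a)) * F θ := by
    simp only [mul_sub, sub_mul]
    rw [intervalIntegral.integral_sub, intervalIntegral.integral_sub, hshift]
    all_goals exact Continuous.intervalIntegrable (by fun_prop) _ _
  rw [heq]
  refine (intervalIntegral.norm_integral_le_of_norm_le_const
    (f := fun θ => (h θ - h (θ - a)) * F θ) (C := B * η) fun θ _ => ?_).trans ?_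
  · rw [Real.norm_eq_abs, abs_mul, mul_comm]
    exact mul_le_mul (hFB θ) (hη θ) (abs_nonneg _) ((abs_nonneg _).trans (hFB θ))
  · rw [sub_zero, abs_of_nonneg hP]

/-- Differences of a periodic family at exponentially small scales average to zero in time, provided
the family varies at scale at least `exp (-2 s)` at time `s`. -/
theorem ae_tendsto_average_sub_translate {F : ℝ → ℝ → ℝ} {a : ℝ → ℝ} {P B C : ℝ} (hP : 0 ≤ P)
    (hB0 : 0 ≤ B) (hC : 0 ≤ C) (hFc : Continuous (Function.uncurry F)) (hac : Continuous a)
    (ha0 : ∀ t, 0 ≤ a t) (ha1 : ∀ t, a t ≤ Real.exp (-2 * t))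
    (hFp : ∀ t, Function.Periodic (F t) P) (hB : ∀ t θ, |F t θ| ≤ B)
    (hosc : ∀ s, 0 ≤ s → ∀ θ δ, |F s (θ + δ) - F s θ| ≤ C * (Real.exp (2 * s) * |δ|)) :
    ∀ᵐ θ ∂(volume.restrict (Set.Icc (0:ℝ) P)),
      Tendsto (fun T : ℝ => T⁻¹ * ∫ t in (0:ℝ)..T, (F t θ - F t (θ + a t))) atTop (𝓝 0) := by
  set f : ℝ → ℝ → ℝ := fun t θ => F t θ - F t (θ + a t) with hfdef
  have hFc' (t : ℝ) : Continuous (F t) := hFc.comp (Continuous.prodMk_right t)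
  have hfc : Continuous (Function.uncurry f) :=
    hFc.sub (hFc.comp (by fun_prop : Continuous fun p : ℝ × ℝ => (p.1, p.2 + a p.1)))
  have hfc' (t : ℝ) : Continuous (f t) := hfc.comp (Continuous.prodMk_right t)
  have hfp (t : ℝ) : Function.Periodic (f t) P := fun θ => by
    simp only [hfdef, add_right_comm θ P, hFp t _]
  have hfB (t θ : ℝ) : |f t θ| ≤ 2 * B := by
    refine (abs_sub _ _).trans ?_
    linarith [hB t θ, hB t (θ + a t)]
  have hfosc {s : ℝ} (hs : 0 ≤ s) (t θ : ℝ) :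
      |f s θ - f s (θ - a t)| ≤ 2 * C * Real.exp (-2 * (t - s)) := by
    have hstep (θ' : ℝ) : |F s θ' - F s (θ' - a t)| ≤ C * Real.exp (-2 * (t - s)) := by
      have h := hosc s hs (θ' - a t) (a t)
      rw [sub_add_cancel, abs_of_nonneg (ha0 t)] at h
      refine h.trans (mul_le_mul_of_nonneg_left ?_ hC)
      calc Real.exp (2 * s) * a t ≤ Real.exp (2 * s) * Real.exp (-2 * t) := by gcongr; exact ha1 t
        _ = _ := by rw [← Real.exp_add]; ring_nf
    have h1 := hstep θ
    have h2 := hstep (θ + a s)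
    have heq : f s θ - f s (θ - a t) =
        (F s θ - F s (θ - a t)) - (F s (θ + a s) - F s (θ + a s - a t)) := by
      simp only [hfdef, add_sub_right_comm θ (a s)]
      ring
    rw [heq]
    refine (abs_sub _ _).trans ?_
    linarith
  have hdecay {s t : ℝ} (hs : 0 ≤ s) :
      |∫ θ in (0:ℝ)..P, f s θ * f t θ| ≤ B * (2 * C * Real.exp (-2 * (t - s))) * P :=
    abs_integral_mul_sub_translate_le hP (hFc' t) (hfc' s) (hFp t) (hfp s)
      (hB t) (hfosc hs t)
  refine ae_tendsto_average_of_integrable_correlation (f := f) (K := 2 * B)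
    (k := fun u => B * (2 * C) * P * Real.exp (-2 * |u|)) hfc.measurable hfB
    ((integrable_exp_neg_mul_abs two_pos).const_mul _) (fun u => by positivity) ?_
  intro s t hs ht
  rw [integral_Icc_eq_integral_Ioc, ← intervalIntegral.integral_of_le hP]
  rcases le_total s t with hst | hst
  · rw [abs_of_nonneg (sub_nonneg.2 hst)]
    exact (hdecay hs).trans_eq (by ring)
  · rw [abs_of_nonpos (sub_nonpos.2 hst), neg_sub]
    simp_rw [mul_comm (f s _)]
    exact (hdecay ht).trans_eq (by ring)

/-- Let `X` be a topological space with a continuous `SL(2,ℝ)`-action, and let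
`φ : X → ℝ` be a bounded continuous function which is Lipschitz in the group variable near the
identity: `|φ(h·y) − φ(y)| ≤ M‖h − I‖` for `h ∈ U` and all `y`.  Fix `x ∈ X` and `0 < α < 1`,
and set `α_t = arctan(α e^{−2t})`, `f_t(θ) = φ(g_t r_θ · x) − φ(g_t r_{θ+α_t} · x)`.  Then for
Lebesgue-almost every `θ ∈ [0, 2π]`, `(1/T) ∫₀^T f_t(θ) dt → 0` as `T → ∞`. -/
theorem stmt2 {X : Type*} [TopologicalSpace X] [MulAction SL2 X]
    (hact : Continuous fun p : SL2 × X => p.1 • p.2)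
    (φ : X → ℝ) (hφcont : Continuous φ) (hφbdd : ∃ B : ℝ, ∀ y : X, |φ y| ≤ B)
    (M : ℝ) (hM : 0 < M) (U : Set SL2) (hU : U ∈ 𝓝 (1 : SL2))
    (hlip : ∀ h ∈ U, ∀ y : X,
      |φ (h • y) - φ y| ≤ M * opNorm2 ((h : Matrix (Fin 2) (Fin 2) ℝ) - 1))
    (x : X) (α : ℝ) (hα₀ : 0 < α) (hα₁ : α < 1) :
    ∀ᵐ θ ∂(volume.restrict (Set.Icc (0:ℝ) (2 * π))),
      Tendsto (fun T : ℝ => T⁻¹ * ∫ t in (0:ℝ)..T,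
          (φ ((gMat t * rMat θ) • x) -
            φ ((gMat t * rMat (θ + Real.arctan (α * Real.exp (-2 * t)))) • x)))
        atTop (𝓝 0) := by
  obtain ⟨B, hB⟩ := hφbdd
  obtain ⟨N, hN, hlipN⟩ := exists_forall_abs_smul_sub_le hB hM hU hlip
  obtain ⟨C, hC, hosc⟩ := exists_forall_abs_orbit_sub_le hN hlipN x
  refine ae_tendsto_average_sub_translate (F := fun t θ => φ ((gMat t * rMat θ) • x))
    (a := fun t => Real.arctan (α * Real.exp (-2 * t))) (by positivity)
    ((abs_nonneg _).trans (hB x)) hC ?_ (by fun_prop)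
    (fun t => Real.arctan_nonneg.2 (by positivity)) (fun t => ?_) (fun t θ => ?_)
    (fun t θ => hB _) hosc
  · exact hφcont.comp (hact.comp (continuous_gMat_mul_rMat.prodMk continuous_const))
  · exact (arctan_le_self (by positivity)).trans
      (mul_le_of_le_one_left (Real.exp_pos _).le hα₁.le)
  · simp only [rMat_add_two_pi]
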